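/- Let k ≥ 2 and n be integers with 2n ≥ k, and let N ≥ 1. Then m_k^n(N) > 0; that is, the infimum over all T > 0 and all k times continuously differentiable v : [−T/2, T/2] → ℝ with v(−T/2) = −1/2, v(T/2) = 1/2 and |v^{(ℓ)}(±T/2)| ≤ 1/N for all ℓ ∈ {1,…,n}, of T + ∫_{−T/2}^{T/2} (v^{(k)}(t))² dt, is strictly positive. -/

import Mathlib

open MeasureTheory Set

/-- The set of admissible energies for the approximate surface energy density `m_k^n(M)`:
values `T + ∫_{-T/2}^{T/2} (v^{(k)})²` over `T > 0` and `v` which are `k` times continuously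
differentiable on `[-T/2, T/2]` with `v(∓T/2) = ∓1/2` and `|v^{(ℓ)}(±T/2)| ≤ 1/M` for
`ℓ ∈ {1,…,n}`.  `m_k^n(M)` is the infimum of this set. -/
def transSet (k n : ℕ) (M : ℝ) : Set ℝ :=
  {E : ℝ | ∃ T : ℝ, 0 < T ∧ ∃ v : ℝ → ℝ,
    ContDiffOn ℝ k v (Icc (-(T/2)) (T/2)) ∧
    v (-(T/2)) = -(1/2) ∧ v (T/2) = 1/2 ∧
    (∀ ℓ : ℕ, 1 ≤ ℓ → ℓ ≤ n →
      |iteratedDerivWithin ℓ v (Icc (-(T/2)) (T/2)) (-(T/2))| ≤ 1 / M ∧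
      |iteratedDerivWithin ℓ v (Icc (-(T/2)) (T/2)) (T/2)| ≤ 1 / M) ∧
    E = T + ∫ t in Icc (-(T/2)) (T/2),
      (iteratedDerivWithin k v (Icc (-(T/2)) (T/2)) t) ^ 2}


lemma aed_deriv (k : ℕ) (t : ℝ) (G L : ℕ → ℝ → ℝ)
    (hG : ∀ j < k, HasDerivAt (G j) (G (j+1) t) t)
    (hL0 : HasDerivAt (L 0) 0 t)
    (hL : ∀ j, j + 1 < k → HasDerivAt (L (j+1)) (L j t) t) (p : ℕ) (hp : p < k) :
    HasDerivAt (fun x => ∑ j ∈ Finset.range (p+1), (-1:ℝ)^j * (G j x * L j x))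
      ((-1)^p * (G (p+1) t * L p t)) t := by
  induction p with
  | zero =>
    have := (hG 0 hp).mul hL0
    simp only [zero_add, Finset.sum_range_one, pow_zero, one_mul]
    refine HasDerivAt.congr_deriv (f := fun x => G 0 x * L 0 x) this ?_
    simp
  | succ p ih =>
    have h1 := ih (by omega)
    have h2 := ((hG (p+1) hp).mul (hL p hp)).const_mul ((-1:ℝ)^(p+1))
    have h3 := h1.add h2
    have e : (fun x => ∑ j ∈ Finset.range (p+1+1), (-1:ℝ)^j * (G j x * L j x)) =
      (fun x => ∑ j ∈ Finset.range (p+1), (-1:ℝ)^j * (G j x * L j x)) +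
      (fun x => (-1:ℝ)^(p+1) * (G (p+1) * L (p+1)) x) := by
      funext x
      rw [Finset.sum_range_succ]
      rfl
    rw [e]
    refine h3.congr_deriv ?_
    ring

open Polynomial in
lemma aed_poly (k n : ℕ) (hk : 2 ≤ k) (hkn : k ≤ 2 * n) :
    ∃ Q : ℝ[X], ∃ C : ℝ, 0 < C ∧ derivative^[k] Q = 0 ∧
      (∃ c : ℝ, 1 ≤ c ∧ ∀ s, (derivative^[k-1] Q).eval s = c) ∧
      (∀ i ≤ k, ∀ s ∈ Icc (0:ℝ) 1, |(derivative^[i] Q).eval s| ≤ C) ∧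
      (∀ j, n < j → j < k → (derivative^[k-1-j] Q).eval 0 = 0 ∧
        (derivative^[k-1-j] Q).eval 1 = 0) := by
  set n' := min n (k-1) with hn'
  set m := k - 1 - n' with hm
  set Q : ℝ[X] := (X - Polynomial.C 0)^n' * (X - Polynomial.C 1)^m with hQ
  have hmon : Q.Monic := ((monic_X_sub_C 0).pow n').mul ((monic_X_sub_C 1).pow m)
  have hdeg : Q.natDegree = k - 1 := by
    rw [hQ, Monic.natDegree_mul ((monic_X_sub_C 0).pow n') ((monic_X_sub_C 1).pow m),
      natDegree_pow, natDegree_pow, natDegree_X_sub_C, natDegree_X_sub_C]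
    omega
  have hb : ∀ i, ∃ C : ℝ, ∀ s ∈ Icc (0:ℝ) 1, |(derivative^[i] Q).eval s| ≤ C := by
    intro i
    obtain ⟨C, hC⟩ := (isCompact_Icc (a := (0:ℝ)) (b := 1)).exists_bound_of_continuousOn
      (derivative^[i] Q).continuous.continuousOn
    exact ⟨C, fun s hs => hC s hs⟩
  choose B hB using hb
  have hB0 : ∀ i, 0 ≤ B i := fun i => (abs_nonneg _).trans (hB i 0 (by simp))
  refine ⟨Q, ∑ i ∈ Finset.range (k+1), B i + 1, ?_, ?_, ⟨((k-1).factorial : ℝ), ?_, ?_⟩, ?_, ?_⟩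
  · have := Finset.sum_nonneg (fun i (_ : i ∈ Finset.range (k+1)) => hB0 i)
    linarith
  · apply iterate_derivative_eq_zero
    omega
  · exact_mod_cast Nat.one_le_iff_ne_zero.mpr (Nat.factorial_ne_zero _)
  · intro s
    have h0 : (derivative^[k-1] Q).natDegree = 0 := by
      have := natDegree_iterate_derivative Q (k-1)
      omega
    rw [eq_C_of_natDegree_eq_zero h0, eval_C, coeff_iterate_derivative]
    have : Q.coeff (0 + (k-1)) = 1 := by
      rw [zero_add, ← hdeg]; exact hmon
    rw [this]
    simp [Nat.descFactorial_self]
  · intro i hi s hs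
    have := Finset.single_le_sum (f := B) (fun i (_ : i ∈ Finset.range (k+1)) => hB0 i)
      (Finset.mem_range.mpr (Nat.lt_succ_of_le hi))
    have := hB i s hs
    linarith
  · intro j h1 h2
    have key : ∀ (x : ℝ) (r : ℕ), (X - Polynomial.C x)^r ∣ Q → k - 1 - j < r →
        (derivative^[k-1-j] Q).eval x = 0 := by
      intro x r hd hr
      have h := pow_sub_dvd_iterate_derivative_of_pow_dvd (k-1-j) hd
      have h' := (dvd_pow_self (X - Polynomial.C x) (by omega : r - (k-1-j) ≠ 0)).trans h
      exact dvd_iff_isRoot.mp h'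
    exact ⟨key 0 n' (Dvd.intro _ rfl) (by omega), key 1 m (Dvd.intro_left _ rfl) (by omega)⟩

open Polynomial in
lemma aed_main (k n : ℕ) (hk : 2 ≤ k) (hkn : k ≤ 2 * n) :
    ∃ D : ℝ, 0 < D ∧ ∀ (a b : ℝ), a < b → b - a ≤ 1 → ∀ G : ℕ → ℝ → ℝ,
      (∀ j < k, ∀ t ∈ Ioo a b, HasDerivAt (G j) (G (j+1) t) t) →
      (∀ j ≤ k, ContinuousOn (G j) (Icc a b)) →
      G 0 b - G 0 a = 1 →
      (∀ j, 1 ≤ j → j ≤ n → |G j a| ≤ 1 ∧ |G j b| ≤ 1) →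
      1 ≤ D * ((b - a) + ∫ t in Icc a b, (G k t)^2) := by
  obtain ⟨Q, C, hC, hQk, ⟨c, hc1, hc⟩, hbd, hv⟩ := aed_poly k n hk hkn
  refine ⟨(2 * k + 1) * C, by positivity, ?_⟩
  intro a b hab hT1 G hG hGc h01 hGb
  set T := b - a with hT
  have hT0 : 0 < T := by linarith
  set L : ℕ → ℝ → ℝ := fun j t => T^j * (derivative^[k-1-j] Q).eval ((t - a)/T) with hL
  have haff : ∀ t, HasDerivAt (fun t : ℝ => (t-a)/T) (1/T) t := fun t =>
    ((hasDerivAt_id t).sub_const a).div_const T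
  have hLd : ∀ j t, HasDerivAt (L j)
      (T^j * ((derivative (derivative^[k-1-j] Q)).eval ((t - a)/T) * (1/T))) t := fun j t =>
    (((derivative^[k-1-j] Q).hasDerivAt _).comp t (haff t)).const_mul (T^j)
  have hL0 : ∀ t, HasDerivAt (L 0) 0 t := by
    intro t
    refine (hLd 0 t).congr_deriv ?_
    rw [← Function.iterate_succ_apply' derivative, show (k-1-0).succ = k by omega, hQk]
    simp
  have hLs : ∀ t j, j + 1 < k → HasDerivAt (L (j+1)) (L j t) t := by
    intro t j hj
    refine (hLd (j+1) t).congr_deriv ?_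
    rw [← Function.iterate_succ_apply' derivative, show (k-1-(j+1)).succ = k-1-j by omega]
    simp only [hL]
    field_simp
    ring
  have hLc : ∀ j, Continuous (L j) := fun j =>
    continuous_iff_continuousAt.mpr fun t => (hLd j t).continuousAt
  have hs : ∀ t ∈ Icc a b, (t - a)/T ∈ Icc (0:ℝ) 1 := by
    intro t ht
    refine ⟨div_nonneg (by linarith [ht.1]) hT0.le, (div_le_one hT0).mpr (by linarith [ht.2])⟩
  have hLb : ∀ j, ∀ t ∈ Icc a b, |L j t| ≤ T^j * C := by
    intro j t ht
    simp only [hL]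
    rw [abs_mul, abs_of_pos (pow_pos hT0 j)]
    exact mul_le_mul_of_nonneg_left (hbd _ (by omega) _ (hs t ht)) (pow_pos hT0 j).le
  have hLv : ∀ j, n < j → j < k → L j a = 0 ∧ L j b = 0 := by
    intro j h1 h2
    have e1 : (a - a)/T = 0 := by simp
    have e2 : (b - a)/T = 1 := div_self hT0.ne'
    simp only [hL, e1, e2, hv j h1 h2, mul_zero, and_self]
  have hL0v : ∀ t, L 0 t = c := by
    intro t
    simp only [hL, pow_zero, one_mul, Nat.sub_zero]
    exact hc _
  set F : ℝ → ℝ := fun x => ∑ j ∈ Finset.range (k-1+1), (-1:ℝ)^j * (G j x * L j x) with hF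
  have hFd : ∀ t ∈ Ioo a b, HasDerivAt F ((-1)^(k-1) * (G k t * L (k-1) t)) t := by
    intro t ht
    have := aed_deriv k t G L (fun j hj => hG j hj t ht) (hL0 t) (hLs t) (k-1) (by omega)
    refine this.congr_deriv ?_
    rw [show k - 1 + 1 = k by omega]
  have hFc : ContinuousOn F (Icc a b) := by
    apply continuousOn_finsetSum
    intro j hj
    have := Finset.mem_range.mp hj
    exact continuousOn_const.mul ((hGc j (by omega)).mul (hLc j).continuousOn)
  have hdc : ContinuousOn (fun t => (-1:ℝ)^(k-1) * (G k t * L (k-1) t)) (Icc a b) :=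
    continuousOn_const.mul ((hGc k le_rfl).mul (hLc _).continuousOn)
  have hftc := intervalIntegral.integral_eq_sub_of_hasDerivAt_of_le hab.le hFc hFd
    (hdc.intervalIntegrable_of_Icc hab.le)
  have hG2c : ContinuousOn (fun t => (G k t)^2) (Icc a b) := (hGc k le_rfl).pow 2
  have hI : |F b - F a| ≤ C * (T + ∫ t in Icc a b, (G k t)^2) := by
    rw [← hftc]
    have h1 : |∫ t in a..b, (-1:ℝ)^(k-1) * (G k t * L (k-1) t)| ≤
        ∫ t in a..b, C * (1 + (G k t)^2) := by
      refine (intervalIntegral.abs_integral_le_integral_abs hab.le).trans ?_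
      apply intervalIntegral.integral_mono_on hab.le
      · exact (hdc.abs).intervalIntegrable_of_Icc hab.le
      · exact (continuousOn_const.mul (continuousOn_const.add hG2c)).intervalIntegrable_of_Icc hab.le
      · intro t ht
        have h2 : |L (k-1) t| ≤ C := (hLb (k-1) t ht).trans
          (mul_le_of_le_one_left hC.le (pow_le_one₀ hT0.le hT1))
        have h3 : |G k t| ≤ 1 + (G k t)^2 := by
          rw [← sq_abs]
          nlinarith [sq_nonneg (|G k t| - 1), abs_nonneg (G k t)]
        rw [abs_mul, abs_mul, abs_pow, abs_neg, abs_one, one_pow, one_mul, mul_comm C]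
        exact mul_le_mul h3 h2 (abs_nonneg _) (by positivity)
    refine h1.trans (le_of_eq ?_)
    rw [intervalIntegral.integral_const_mul, intervalIntegral.integral_add
      (by simp) (hG2c.intervalIntegrable_of_Icc hab.le), intervalIntegral.integral_const,
      intervalIntegral.integral_of_le hab.le, ← integral_Icc_eq_integral_Ioc]
    simp [hT]
  have hFe : ∀ x, F x = ∑ j ∈ Finset.range (k-1), (-1:ℝ)^(j+1) * (G (j+1) x * L (j+1) x)
      + G 0 x * c := by
    intro x
    simp only [hF]
    rw [Finset.sum_range_succ', hL0v]
    simp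
  have hR : ∀ x, x ∈ Icc a b → (∀ j, 1 ≤ j → j ≤ n → |G j x| ≤ 1) →
      (∀ j, n < j → j < k → L j x = 0) →
      |∑ j ∈ Finset.range (k-1), (-1:ℝ)^(j+1) * (G (j+1) x * L (j+1) x)| ≤ k * (C * T) := by
    intro x hx h1 h2
    refine (Finset.abs_sum_le_sum_abs _ _).trans ?_
    have : ∀ j ∈ Finset.range (k-1),
        |(-1:ℝ)^(j+1) * (G (j+1) x * L (j+1) x)| ≤ C * T := by
      intro j hj
      have hj := Finset.mem_range.mp hj
      rw [abs_mul, abs_mul, abs_pow, abs_neg, abs_one, one_pow, one_mul]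
      by_cases hjn : j + 1 ≤ n
      · have h3 := hLb (j+1) x hx
        have h4 : T^(j+1) ≤ T := pow_le_of_le_one hT0.le hT1 (by omega)
        calc _ ≤ 1 * |L (j+1) x| := mul_le_mul_of_nonneg_right (h1 _ (by omega) hjn) (abs_nonneg _)
          _ ≤ T^(j+1) * C := by rw [one_mul]; exact h3
          _ ≤ T * C := mul_le_mul_of_nonneg_right h4 hC.le
          _ = _ := mul_comm _ _
      · rw [h2 (j+1) (by omega) (by omega)]
        simp
        positivity
    refine (Finset.sum_le_card_nsmul _ _ _ this).trans ?_
    rw [Finset.card_range, nsmul_eq_mul]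
    have : ((k-1 : ℕ):ℝ) ≤ k := by exact_mod_cast Nat.sub_le _ _
    exact mul_le_mul_of_nonneg_right this (by positivity)
  have hRa := abs_le.mp (hR a (left_mem_Icc.mpr hab.le) (fun j h1 h2 => (hGb j h1 h2).1)
    (fun j h1 h2 => (hLv j h1 h2).1))
  have hRb := abs_le.mp (hR b (right_mem_Icc.mpr hab.le) (fun j h1 h2 => (hGb j h1 h2).2)
    (fun j h1 h2 => (hLv j h1 h2).2))
  have hI0 : 0 ≤ ∫ t in Icc a b, (G k t)^2 := integral_nonneg fun t => sq_nonneg _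
  have hI' := (abs_le.mp hI).2
  rw [hFe b, hFe a] at hI'
  have hc' : G 0 b * c - G 0 a * c = c := by rw [← sub_mul, h01, one_mul]
  have hkC : 0 ≤ 2 * (k:ℝ) * C * ∫ t in Icc a b, (G k t)^2 := by positivity
  nlinarith [hRa.1, hRa.2, hRb.1, hRb.2]

/-- for integers `k ≥ 2` and `n` with `2n ≥ k`, and any `N ≥ 1`,
the approximate surface energy density `m_k^n(N) = inf (transSet k n N)` is strictly
positive (Remark 2.4 of the paper). -/
theorem approximate_energy_density_pos (k n : ℕ) (hk : 2 ≤ k) (hkn : k ≤ 2 * n)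
    (N : ℝ) (hN : 1 ≤ N) :
    0 < sInf (transSet k n N) := by
  obtain ⟨D, hD, hmain⟩ := aed_main k n hk hkn
  have hne : (transSet k n N).Nonempty := by
    have hN0 : 0 < N := by linarith
    refine ⟨_, N, hN0, fun t => N⁻¹ * t, by fun_prop, by field_simp, by field_simp, ?_, rfl⟩
    have hu : UniqueDiffOn ℝ (Icc (-(N/2)) (N/2)) := uniqueDiffOn_Icc (by linarith)
    have key : ∀ ℓ, 1 ≤ ℓ → ∀ x ∈ Icc (-(N/2)) (N/2),
        |iteratedDerivWithin ℓ (fun t => N⁻¹ * t) (Icc (-(N/2)) (N/2)) x| ≤ 1 / N := by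
      intro ℓ hℓ x hx
      obtain ⟨p, rfl⟩ := Nat.exists_eq_add_of_le' hℓ
      rw [iteratedDerivWithin_succ', iteratedDerivWithin_congr (g := fun _ => N⁻¹) _ hx]
      · rw [iteratedDerivWithin_const]
        split_ifs
        · rw [abs_of_pos (by positivity)]; simp
        · simp; positivity
      · intro y hy
        have : HasDerivAt (fun t : ℝ => N⁻¹ * t) (N⁻¹ * 1) y := (hasDerivAt_id y).const_mul _
        rw [this.hasDerivWithinAt.derivWithin (hu y hy), mul_one]
    intro ℓ h1 _
    exact ⟨key ℓ h1 _ (by constructor <;> linarith), key ℓ h1 _ (by constructor <;> linarith)⟩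
  refine lt_of_lt_of_le (b := min 1 (1/D)) (lt_min one_pos (by positivity)) (le_csInf hne ?_)
  rintro E ⟨T, hT, v, hv, hva, hvb, hbd, rfl⟩
  have hI0 : 0 ≤ ∫ t in Icc (-(T/2)) (T/2),
      (iteratedDerivWithin k v (Icc (-(T/2)) (T/2)) t) ^ 2 := integral_nonneg fun t => sq_nonneg _
  rcases le_total 1 T with h1 | h1
  · exact (min_le_left _ _).trans (by linarith)
  · refine (min_le_right _ _).trans ?_
    have hu : UniqueDiffOn ℝ (Icc (-(T/2)) (T/2)) := uniqueDiffOn_Icc (by linarith)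
    have hN1 : 1 / N ≤ 1 := by rw [div_le_one (by linarith)]; exact hN
    have := hmain (-(T/2)) (T/2) (by linarith) (by linarith)
      (fun j => iteratedDerivWithin j v (Icc (-(T/2)) (T/2))) ?_ ?_ ?_ ?_
    · rw [div_le_iff₀ hD, mul_comm]
      rwa [show T/2 - -(T/2) = T by ring] at this
    · intro j hj t ht
      have hd := hv.differentiableOn_iteratedDerivWithin (m := j) (by exact_mod_cast hj) hu t
        (Ioo_subset_Icc_self ht)
      have := hd.hasDerivWithinAt
      rw [← iteratedDerivWithin_succ] at this
      exact this.hasDerivAt (Icc_mem_nhds ht.1 ht.2)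
    · intro j hj
      exact hv.continuousOn_iteratedDerivWithin (by exact_mod_cast hj) hu
    · simp only [iteratedDerivWithin_zero, hva, hvb]; norm_num
    · intro j h1 h2
      exact ⟨(hbd j h1 h2).1.trans hN1, (hbd j h1 h2).2.trans hN1⟩
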